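/- Let φ = (1 + √5)/2. For every real ε > 0 and every deterministic online algorithm for cardinality constrained scheduling on m = 2 machines with cardinality bound k = 2, there exists an input sequence of at most 4 jobs on which the induced schedule is either infeasible or has makespan at least (φ − ε)·OPT; hence no online algorithm for m = k = 2 is α-competitive for any α < φ. -/

import Mathlib

open Finset

/-- The load of machine `i` under schedule `σ` for job sizes `p`. -/
noncomputable def machineLoad {n m : ℕ} (p : Fin n → ℝ) (σ : Fin n → Fin m) (i : Fin m) : ℝ :=
  ∑ j ∈ Finset.univ.filter (fun j => σ j = i), p j

/-- The makespan of a schedule: the maximum machine load. -/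
noncomputable def makespan {n m : ℕ} (p : Fin n → ℝ) (σ : Fin n → Fin m) : ℝ :=
  sSup (Set.range (machineLoad p σ))

/-- A schedule is feasible for cardinality bound `k` if every machine gets at most `k` jobs. -/
def Feasible {n m : ℕ} (k : ℕ) (σ : Fin n → Fin m) : Prop :=
  ∀ i : Fin m, (Finset.univ.filter (fun j => σ j = i)).card ≤ k

/-- The optimal (minimum) makespan over all feasible schedules on `m` machines with
cardinality bound `k`. -/
noncomputable def OPT (m k : ℕ) {n : ℕ} (p : Fin n → ℝ) : ℝ :=
  sInf ((fun σ : Fin n → Fin m => makespan p σ) '' {σ | Feasible k σ})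

/-- The schedule induced by a deterministic online algorithm `A` on input sequence `p`:
job `j` is assigned to the machine `A (p 1, …, p j)`. -/
def onlineSchedule {m : ℕ} (A : List ℝ → Fin m) {n : ℕ} (p : Fin n → ℝ) : Fin n → Fin m :=
  fun j => A ((List.ofFn p).take (j.1 + 1))

/-- An online algorithm is `α`-competitive if on every input sequence of at most `m*k`
nonnegative jobs the induced schedule is feasible and its makespan is at most `α * OPT`. -/
def Competitive (m k : ℕ) (A : List ℝ → Fin m) (α : ℝ) : Prop :=
  ∀ n : ℕ, n ≤ m * k → ∀ p : Fin n → ℝ, (∀ j, 0 ≤ p j) →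
    Feasible k (onlineSchedule A p) ∧
      makespan p (onlineSchedule A p) ≤ α * OPT m k p

theorem machineLoad_le_makespan {n m : ℕ} (p : Fin n → ℝ) (σ : Fin n → Fin m) (i : Fin m) :
    machineLoad p σ i ≤ makespan p σ :=
  le_csSup (Set.finite_range _).bddAbove ⟨i, rfl⟩

theorem makespan_le {n m : ℕ} [NeZero m] {p : Fin n → ℝ} {σ : Fin n → Fin m} {c : ℝ}
    (h : ∀ i, machineLoad p σ i ≤ c) : makespan p σ ≤ c :=
  csSup_le (Set.range_nonempty _) (Set.forall_mem_range.2 h)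

theorem le_makespan {n m : ℕ} {p : Fin n → ℝ} (hp : ∀ j, 0 ≤ p j) (σ : Fin n → Fin m)
    (j : Fin n) : p j ≤ makespan p σ :=
  (single_le_sum (fun i _ => hp i) (by simp)).trans (machineLoad_le_makespan p σ (σ j))

theorem add_le_makespan {n m : ℕ} {p : Fin n → ℝ} (hp : ∀ j, 0 ≤ p j) {σ : Fin n → Fin m}
    {i j : Fin n} (hij : i ≠ j) (h : σ i = σ j) : p i + p j ≤ makespan p σ := by
  refine le_trans ?_ (machineLoad_le_makespan p σ (σ j))
  rw [← sum_pair hij]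
  exact sum_le_sum_of_subset_of_nonneg (by simp [insert_subset_iff, h]) fun i _ _ => hp i

theorem OPT_le {n m k : ℕ} [NeZero m] {p : Fin n → ℝ} {c : ℝ} (σ : Fin n → Fin m)
    (hσ : Feasible k σ) (h : ∀ i, machineLoad p σ i ≤ c) : OPT m k p ≤ c :=
  (csInf_le (Set.toFinite _).bddBelow (Set.mem_image_of_mem _ hσ)).trans (makespan_le h)

theorem le_OPT {n m k : ℕ} {p : Fin n → ℝ} (hp : ∀ j, 0 ≤ p j) (σ : Fin n → Fin m)
    (hσ : Feasible k σ) (j : Fin n) : p j ≤ OPT m k p :=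
  le_csInf (Set.Nonempty.image _ ⟨σ, hσ⟩) (Set.forall_mem_image.2 fun τ _ => le_makespan hp τ j)

theorem Feasible.eq_of_eq {σ : Fin 4 → Fin 2} (h : Feasible 2 σ) :
    (σ 0 = σ 1 → σ 2 = σ 3) ∧ (σ 0 = σ 2 → σ 1 = σ 3) := by
  unfold Feasible at h
  revert σ
  decide

/-- The adversary forces the ratio `φ` on an instance with positive optimum. -/
theorem exists_goldenRatio_mul_OPT_le_makespan (A : List ℝ → Fin 2) :
    ∃ n : ℕ, n ≤ 4 ∧ ∃ p : Fin n → ℝ, (∀ j, 0 ≤ p j) ∧ 0 < OPT 2 2 p ∧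
      (¬ Feasible 2 (onlineSchedule A p) ∨
        Real.goldenRatio * OPT 2 2 p ≤ makespan p (onlineSchedule A p)) := by
  have hφ := Real.goldenRatio_sq
  have h1 := Real.one_lt_goldenRatio
  have h2 := Real.goldenRatio_lt_two
  set φ := Real.goldenRatio
  by_cases h01 : A [0] = A [0, 1]
  · have hp : ∀ j, 0 ≤ (![0, 1, 5, 5] : Fin 4 → ℝ) j := by
      intro j; fin_cases j <;> norm_num
    have hσ : Feasible 2 (![0, 1, 0, 1] : Fin 4 → Fin 2) := by unfold Feasible; decide
    refine ⟨4, le_rfl, ![0, 1, 5, 5], hp, one_pos.trans_le (le_OPT hp _ hσ 1), ?_⟩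
    refine or_iff_not_imp_left.2 fun hf => ?_
    have hOPT : OPT 2 2 (![0, 1, 5, 5] : Fin 4 → ℝ) ≤ 6 := OPT_le _ hσ fun i => by
      fin_cases i <;> simp [machineLoad, sum_filter, Fin.sum_univ_four] <;> norm_num
    have hA := add_le_makespan hp (by decide)
      ((not_not.1 hf).eq_of_eq.1 (by simpa [onlineSchedule] using h01))
    simp only [Matrix.cons_val] at hA
    nlinarith
  by_cases h12 : A [0, 1] = A [0, 1, φ - 1]
  · have hp : ∀ j, 0 ≤ (![0, 1, φ - 1] : Fin 3 → ℝ) j := by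
      intro j; fin_cases j <;> simp [h1.le]
    have hσ : Feasible 2 (![0, 1, 0] : Fin 3 → Fin 2) := by unfold Feasible; decide
    refine ⟨3, by norm_num, ![0, 1, φ - 1], hp, one_pos.trans_le (le_OPT hp _ hσ 1), Or.inr ?_⟩
    have hOPT : OPT 2 2 (![0, 1, φ - 1] : Fin 3 → ℝ) ≤ 1 := OPT_le _ hσ fun i => by
      fin_cases i <;> simp [machineLoad, sum_filter, Fin.sum_univ_three]
      linarith
    have hA := add_le_makespan hp (σ := onlineSchedule A ![0, 1, φ - 1]) (i := 1) (j := 2)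
      (by decide) (by simpa [onlineSchedule] using h12)
    simp only [Matrix.cons_val] at hA
    nlinarith
  · have h02 : A [0] = A [0, 1, φ - 1] := by omega
    have hp : ∀ j, 0 ≤ (![0, 1, φ - 1, φ] : Fin 4 → ℝ) j := by
      intro j; fin_cases j <;> simp [h1.le, (one_pos.trans h1).le]
    have hσ : Feasible 2 (![0, 1, 1, 0] : Fin 4 → Fin 2) := by unfold Feasible; decide
    refine ⟨4, le_rfl, ![0, 1, φ - 1, φ], hp, one_pos.trans_le (le_OPT hp _ hσ 1), ?_⟩
    refine or_iff_not_imp_left.2 fun hf => ?_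
    have hOPT : OPT 2 2 (![0, 1, φ - 1, φ] : Fin 4 → ℝ) ≤ φ := OPT_le _ hσ fun i => by
      fin_cases i <;> simp [machineLoad, sum_filter, Fin.sum_univ_four]
    have hA := add_le_makespan hp (by decide)
      ((not_not.1 hf).eq_of_eq.2 (by simpa [onlineSchedule] using h02))
    simp only [Matrix.cons_val] at hA
    nlinarith

/-- Let `φ = (1 + √5)/2`.  For every `ε > 0` and every deterministic online algorithm for
cardinality constrained scheduling on `m = 2` machines with cardinality bound `k = 2`, there
is an input sequence of at most `4` jobs on which the induced schedule is infeasible or has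
makespan at least `(φ - ε) * OPT`. -/
theorem golden_ratio_lower_bound_m2_k2 :
    ∀ ε : ℝ, 0 < ε →
      ∀ A : List ℝ → Fin 2,
        ∃ n : ℕ, n ≤ 4 ∧
          ∃ p : Fin n → ℝ, (∀ j, 0 ≤ p j) ∧
            (¬ Feasible 2 (onlineSchedule A p) ∨
              ((1 + Real.sqrt 5) / 2 - ε) * OPT 2 2 p ≤ makespan p (onlineSchedule A p)) := by
  intro ε hε A
  obtain ⟨n, hn, p, hp, hpos, h⟩ := exists_goldenRatio_mul_OPT_le_makespan A
  refine ⟨n, hn, p, hp, h.imp_right fun h => le_trans ?_ h⟩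
  exact mul_le_mul_of_nonneg_right (sub_le_self _ hε.le) hpos.le
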